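/- Fix p ∈ (0,1). Then, uniformly over starting permutations, E_{S_n}(σ) ≤ ((1+√(1−p))/p)·n + o_p(n) as n → ∞; precisely, limsup_{n→∞} (max_{σ ∈ S_n} E_{S_n}(σ) − ((1+√(1−p))/p)·n)/n ≤ 0. -/

import Mathlib

open scoped Classical ENNReal

noncomputable section

namespace Ungarian

variable {L : Type*} [Fintype L]

/-- `y` is covered by `x` with respect to the order relation `le`. -/
def CovRel (le : L → L → Prop) (x y : L) : Prop :=
  le y x ∧ y ≠ x ∧ ∀ z, le y z → le z x → z = y ∨ z = x

/-- The finset of elements covered by `x`. -/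
def covFinset (le : L → L → Prop) (x : L) : Finset L :=
  Finset.univ.filter fun y => CovRel le x y

/-- `m` is a greatest lower bound of `S` with respect to `le`. -/
def IsMeetOf (le : L → L → Prop) (S : Set L) (m : L) : Prop :=
  (∀ s ∈ S, le m s) ∧ ∀ z, (∀ s ∈ S, le z s) → le z m

/-- The meet of `{x} ∪ T`. -/
def meetOf (le : L → L → Prop) (x : L) (T : Finset L) : L :=
  if h : ∃ m, IsMeetOf le (insert x (T : Set L)) m then h.choose else x

/-- One-step transition probabilities of the Ungarian Markov chain with parameter `p`:
from `x`, a random subset `T` of the set of elements covered by `x` is chosen, each element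
independently with probability `p`, and the chain moves to the meet of `{x} ∪ T`. -/
def stepProb (p : ℝ) (le : L → L → Prop) (x y : L) : ℝ≥0∞ :=
  ∑ T ∈ (covFinset le x).powerset,
    if meetOf le x T = y then
      ENNReal.ofReal (p ^ T.card * (1 - p) ^ ((covFinset le x).card - T.card))
    else 0

/-- Distribution after `t` steps started from `x`. -/
def walk (p : ℝ) (le : L → L → Prop) (x : L) : ℕ → L → ℝ≥0∞
  | 0 => fun y => if y = x then 1 else 0
  | t + 1 => fun y => ∑ z : L, walk p le x t z * stepProb p le z y

/-- Probability that the chain started at `x` lies in `S` after `t` steps. -/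
def probIn (p : ℝ) (le : L → L → Prop) (x : L) (t : ℕ) (S : Set L) : ℝ≥0∞ :=
  ∑ y ∈ Finset.univ.filter (· ∈ S), walk p le x t y

/-- Expected number of steps until absorption at `bot`, computed as `∑_t P(X_t ≠ bot)`. -/
def expAbsorb (p : ℝ) (le : L → L → Prop) (x bot : L) : ℝ≥0∞ :=
  ∑' t : ℕ, probIn p le x t {y | y ≠ bot}

end Ungarian

/-- `τ` is covered by `σ` in the right weak order on `S_n`:
`τ = σ ∘ (i i+1)` for a descent `i` of `σ`. -/
def wCov {n : ℕ} (σ τ : Equiv.Perm (Fin n)) : Prop :=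
  ∃ i : ℕ, ∃ h : i + 1 < n,
    σ ⟨i + 1, h⟩ < σ ⟨i, Nat.lt_of_succ_lt h⟩ ∧
    τ = σ * Equiv.swap ⟨i, Nat.lt_of_succ_lt h⟩ ⟨i + 1, h⟩

/-- The right weak order on `S_n`: reflexive-transitive closure of the covering relations. -/
def weakLe {n : ℕ} (τ σ : Equiv.Perm (Fin n)) : Prop :=
  Relation.ReflTransGen (fun a b => wCov a b) σ τ

/-- `E_{S_n}(σ)`: expected number of steps for the Ungarian Markov chain on the weak order of
`S_n` started at `σ` to reach the identity. -/
def EpSnFrom (p : ℝ) (n : ℕ) (σ : Equiv.Perm (Fin n)) : ℝ :=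
  (Ungarian.expAbsorb p (fun a b : Equiv.Perm (Fin n) => weakLe a b) σ 1).toReal

/-- Average of `F` over a random subset of `S` containing each element independently, with
weight `P` for the elements taken and `Q` for the elements left out. -/
def subsetAvg {ι : Type*} (P Q : ℝ≥0∞) (S : Finset ι) (F : Finset ι → ℝ≥0∞) : ℝ≥0∞ :=
  ∑ T ∈ S.powerset, P ^ T.card * Q ^ (S.card - T.card) * F T

section SubsetAvg

variable {ι κ : Type*} {P Q : ℝ≥0∞}

lemma subsetAvg_empty (F : Finset ι → ℝ≥0∞) : subsetAvg P Q ∅ F = F ∅ := by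
  simp [subsetAvg]

lemma subsetAvg_mono {S : Finset ι} {F G : Finset ι → ℝ≥0∞} (h : ∀ T ⊆ S, F T ≤ G T) :
    subsetAvg P Q S F ≤ subsetAvg P Q S G :=
  Finset.sum_le_sum fun T hT => by gcongr; exact h T (Finset.mem_powerset.1 hT)

lemma subsetAvg_congr {S : Finset ι} {F G : Finset ι → ℝ≥0∞} (h : ∀ T ⊆ S, F T = G T) :
    subsetAvg P Q S F = subsetAvg P Q S G :=
  le_antisymm (subsetAvg_mono fun T hT => (h T hT).le) (subsetAvg_mono fun T hT => (h T hT).ge)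

variable [DecidableEq ι] [DecidableEq κ]

lemma subsetAvg_insert {a : ι} {S : Finset ι} (ha : a ∉ S) (F : Finset ι → ℝ≥0∞) :
    subsetAvg P Q (insert a S) F =
      Q * subsetAvg P Q S F + P * subsetAvg P Q S (fun T => F (insert a T)) := by
  unfold subsetAvg
  rw [Finset.sum_powerset_insert ha, Finset.mul_sum, Finset.mul_sum]
  congr 1
  · refine Finset.sum_congr rfl fun T hT => ?_
    have hc := Finset.card_le_card (Finset.mem_powerset.1 hT)
    rw [Finset.card_insert_of_notMem ha, Nat.sub_add_comm hc, pow_succ]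
    ring
  · refine Finset.sum_congr rfl fun T hT => ?_
    rw [Finset.card_insert_of_notMem ha,
      Finset.card_insert_of_notMem fun h => ha (Finset.mem_powerset.1 hT h),
      Nat.add_sub_add_right, pow_succ]
    ring

lemma subsetAvg_inter (hPQ : Q + P = 1) (S R : Finset ι) (F : Finset ι → ℝ≥0∞) :
    subsetAvg P Q (S ∪ R) (fun T => F (T ∩ S)) = subsetAvg P Q S F := by
  induction R using Finset.induction_on with
  | empty =>
    rw [Finset.union_empty]
    exact subsetAvg_congr fun T hT => by rw [Finset.inter_eq_left.2 hT]
  | insert a R ha ih =>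
    by_cases haS : a ∈ S
    · rwa [Finset.union_insert, Finset.insert_eq_of_mem (Finset.mem_union_left _ haS)]
    · rw [Finset.union_insert, subsetAvg_insert (by simp [haS, ha])]
      simp only [Finset.insert_inter_of_notMem haS]
      rw [ih, ← add_mul, hPQ, one_mul]

lemma subsetAvg_inter_of_subset (hPQ : Q + P = 1) {S R : Finset ι} (h : S ⊆ R)
    (F : Finset ι → ℝ≥0∞) :
    subsetAvg P Q R (fun T => F (T ∩ S)) = subsetAvg P Q S F := by
  rw [← subsetAvg_inter hPQ S R F, Finset.union_eq_right.2 h]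

lemma subsetAvg_image {f : ι → κ} {S : Finset ι} (hf : Set.InjOn f S) (F : Finset κ → ℝ≥0∞) :
    subsetAvg P Q (S.image f) F = subsetAvg P Q S (fun T => F (T.image f)) := by
  induction S using Finset.induction_on generalizing F with
  | empty => simp [subsetAvg_empty]
  | insert a S ha ih =>
    have hS : Set.InjOn f S := hf.mono (by simp)
    have hfa : f a ∉ S.image f := by
      intro h
      obtain ⟨b, hb, hab⟩ := Finset.mem_image.1 h
      have := hf (by simp [hb]) (by simp) hab
      exact ha (this ▸ hb)
    rw [Finset.image_insert, subsetAvg_insert hfa, subsetAvg_insert ha, ih hS, ih hS]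
    simp only [Finset.image_insert]

lemma subsetAvg_const (hPQ : Q + P = 1) (S : Finset ι) (c : ℝ≥0∞) :
    subsetAvg P Q S (fun _ => c) = c := by
  induction S using Finset.induction_on with
  | empty => rw [subsetAvg_empty]
  | insert a S ha ih => rw [subsetAvg_insert ha, ih, ← add_mul, hPQ, one_mul]

lemma subsetAvg_range_succ (m : ℕ) (F : Finset ℕ → ℝ≥0∞) :
    subsetAvg P Q (Finset.range (m + 1)) F =
      Q * subsetAvg P Q (Finset.range m) (fun T => F (T.image Nat.succ)) +
      P * subsetAvg P Q (Finset.range m) (fun T => F (insert 0 (T.image Nat.succ))) := by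
  have h : Finset.range (m + 1) = insert 0 ((Finset.range m).image Nat.succ) := by
    ext i
    cases i <;> simp
  rw [h, subsetAvg_insert (by simp), subsetAvg_image Nat.succ_injective.injOn,
    subsetAvg_image Nat.succ_injective.injOn]

end SubsetAvg

/-- One-step operator of the Ungarian Markov chain acting on functions. -/
def stepOp {L : Type*} [Fintype L] (p : ℝ) (le : L → L → Prop) (f : L → ℝ≥0∞) (x : L) : ℝ≥0∞ :=
  subsetAvg (ENNReal.ofReal p) (ENNReal.ofReal (1 - p)) (Ungarian.covFinset le x)
    (fun T => f (Ungarian.meetOf le x T))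

section StepOp

variable {L : Type*} [Fintype L] {p : ℝ}

lemma sum_stepProb_mul (hp0 : 0 ≤ p) (hp1 : p ≤ 1) (le : L → L → Prop) (f : L → ℝ≥0∞) (x : L) :
    ∑ y, Ungarian.stepProb p le x y * f y = stepOp p le f x := by
  unfold Ungarian.stepProb stepOp subsetAvg
  simp_rw [Finset.sum_mul]
  rw [Finset.sum_comm]
  refine Finset.sum_congr rfl fun T _ => ?_
  simp only [ite_mul, zero_mul, Finset.sum_ite_eq, Finset.mem_univ, if_true]
  rw [ENNReal.ofReal_mul (pow_nonneg hp0 _), ENNReal.ofReal_pow hp0,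
    ENNReal.ofReal_pow (sub_nonneg.2 hp1)]

lemma sum_walk_mul (hp0 : 0 ≤ p) (hp1 : p ≤ 1) (le : L → L → Prop) (t : ℕ) (f : L → ℝ≥0∞)
    (x : L) : ∑ y, Ungarian.walk p le x t y * f y = (stepOp p le)^[t] f x := by
  induction t generalizing f with
  | zero => simp [Ungarian.walk]
  | succ t ih =>
    rw [Function.iterate_succ_apply, ← ih]
    simp only [Ungarian.walk, Finset.sum_mul]
    rw [Finset.sum_comm]
    refine Finset.sum_congr rfl fun z _ => ?_
    rw [← sum_stepProb_mul hp0 hp1, Finset.mul_sum]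
    exact Finset.sum_congr rfl fun y _ => mul_assoc _ _ _

lemma stepOp_iterate_le_one (hPQ : ENNReal.ofReal (1 - p) + ENNReal.ofReal p = 1)
    (le : L → L → Prop) (t : ℕ) {f : L → ℝ≥0∞} (hf : ∀ x, f x ≤ 1) (x : L) :
    (stepOp p le)^[t] f x ≤ 1 := by
  induction t generalizing x with
  | zero => exact hf x
  | succ t ih =>
    rw [Function.iterate_succ_apply']
    exact (subsetAvg_mono fun T _ => ih _).trans (subsetAvg_const hPQ _ 1).le

lemma probIn_eq (hp0 : 0 ≤ p) (hp1 : p ≤ 1) (le : L → L → Prop) (x : L) (t : ℕ) (S : Set L) :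
    Ungarian.probIn p le x t S = (stepOp p le)^[t] (fun y => if y ∈ S then 1 else 0) x := by
  rw [← sum_walk_mul hp0 hp1]
  simp [Ungarian.probIn, Finset.sum_filter]

end StepOp

/-- `b` stands before the smaller value `a` in `σ`. -/
def IsInv {n : ℕ} (σ : Equiv.Perm (Fin n)) (a b : Fin n) : Prop :=
  a < b ∧ σ.symm b < σ.symm a

section WeakOrder

variable {n : ℕ} {σ τ : Equiv.Perm (Fin n)}

lemma isInv_mul_swap_iff {i : ℕ} (h : i + 1 < n)
    (hd : σ ⟨i + 1, h⟩ < σ ⟨i, Nat.lt_of_succ_lt h⟩) (a b : Fin n) :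
    IsInv (σ * Equiv.swap ⟨i, Nat.lt_of_succ_lt h⟩ ⟨i + 1, h⟩) a b ↔
      IsInv σ a b ∧ ¬ (a = σ ⟨i + 1, h⟩ ∧ b = σ ⟨i, Nat.lt_of_succ_lt h⟩) := by
  obtain ⟨x, rfl⟩ := σ.surjective a
  obtain ⟨y, rfl⟩ := σ.surjective b
  have key : ∀ z : Fin n,
      (σ * Equiv.swap (⟨i, Nat.lt_of_succ_lt h⟩ : Fin n) ⟨i + 1, h⟩).symm (σ z) =
        Equiv.swap (⟨i, Nat.lt_of_succ_lt h⟩ : Fin n) ⟨i + 1, h⟩ z := by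
    intro z
    rw [Equiv.symm_apply_eq, Equiv.Perm.mul_apply, Equiv.swap_apply_self]
  simp only [IsInv, key, Equiv.symm_apply_apply, σ.injective.eq_iff]
  by_cases hx : x = ⟨i, Nat.lt_of_succ_lt h⟩ <;> by_cases hy : y = ⟨i + 1, h⟩
  · subst hx hy
    simp [hd.not_gt]
  all_goals
    simp only [Equiv.swap_apply_def]
    split_ifs <;> simp only [Fin.ext_iff, Fin.lt_def] at * <;> omega

lemma IsInv.of_weakLe (h : weakLe τ σ) {a b : Fin n} (hab : IsInv τ a b) : IsInv σ a b := by
  induction h with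
  | refl => exact hab
  | tail _ hc ih =>
    obtain ⟨i, hi, hd, rfl⟩ := hc
    exact ih ((isInv_mul_swap_iff hi hd a b).1 hab).1

lemma lt_of_forall_lt_succ {f : Fin n → ℕ} {i j : Fin n} (hij : i < j)
    (h : ∀ (l : ℕ) (hl : l + 1 < n), (i : ℕ) ≤ l → l < j →
      f ⟨l, Nat.lt_of_succ_lt hl⟩ < f ⟨l + 1, hl⟩) : f i < f j := by
  obtain ⟨j, hj⟩ := j
  induction j with
  | zero => exact absurd hij (by simp [Fin.lt_def])
  | succ j ih =>
    have hlast := h j hj (by simpa [Fin.lt_def, Nat.lt_succ_iff] using hij) (by simp)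
    rcases eq_or_lt_of_le (show (i : ℕ) ≤ j by simpa [Fin.lt_def, Nat.lt_succ_iff] using hij) with
      he | hlt
    · have : i = ⟨j, Nat.lt_of_succ_lt hj⟩ := Fin.ext he
      rwa [← this] at hlast
    · refine (ih (Nat.lt_of_succ_lt hj) hlt fun l hl h1 h2 => h l hl h1 ?_).trans hlast
      exact Nat.lt_succ_of_lt h2

lemma eq_of_forall_isInv (h : ∀ a b, IsInv τ a b → IsInv σ a b)
    (hd : ∀ (i : ℕ) (hi : i + 1 < n), σ ⟨i + 1, hi⟩ < σ ⟨i, Nat.lt_of_succ_lt hi⟩ →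
      IsInv τ (σ ⟨i + 1, hi⟩) (σ ⟨i, Nat.lt_of_succ_lt hi⟩)) : τ = σ := by
  have hmono : StrictMono (fun i => τ.symm (σ i)) := by
    intro i j hij
    refine lt_of_forall_lt_succ (f := fun i => (τ.symm (σ i) : ℕ)) hij fun l hl _ _ => ?_
    rcases lt_trichotomy (σ ⟨l + 1, hl⟩) (σ ⟨l, Nat.lt_of_succ_lt hl⟩) with hlt | heq | hgt
    · exact (hd l hl hlt).2
    · have := σ.injective heq
      simp at this
    · by_contra hcon
      have hne : τ.symm (σ ⟨l + 1, hl⟩) ≠ τ.symm (σ ⟨l, Nat.lt_of_succ_lt hl⟩) := by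
        intro he
        exact hgt.ne' (τ.symm.injective he)
      have := (h _ _ ⟨hgt, lt_of_le_of_ne (not_lt.1 hcon) hne⟩).2
      simp [Fin.lt_def] at this
  have hid : (fun i => τ.symm (σ i)) = id := by
    refine (hmono.range_inj strictMono_id).1 ?_
    rw [Set.range_id]
    exact (τ.symm.surjective.comp σ.surjective).range_eq
  ext i
  have := congrFun hid i
  simp only [id] at this
  rw [Equiv.symm_apply_eq] at this
  rw [this]

lemma eq_of_isInv_iff (h : ∀ a b, IsInv τ a b ↔ IsInv σ a b) : τ = σ :=
  eq_of_forall_isInv (fun a b => (h a b).1) fun i hi hlt =>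
    (h _ _).2 ⟨hlt, by simp [Fin.lt_def]⟩

lemma weakLe_of_forall_isInv (h : ∀ a b, IsInv τ a b → IsInv σ a b) : weakLe τ σ := by
  induction hN : (Finset.univ.filter fun x : Fin n × Fin n => IsInv σ x.1 x.2).card using
    Nat.strong_induction_on generalizing σ with
  | _ N ih =>
    by_cases hd : ∀ (i : ℕ) (hi : i + 1 < n), σ ⟨i + 1, hi⟩ < σ ⟨i, Nat.lt_of_succ_lt hi⟩ →
      IsInv τ (σ ⟨i + 1, hi⟩) (σ ⟨i, Nat.lt_of_succ_lt hi⟩)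
    · rw [eq_of_forall_isInv h hd]
      exact Relation.ReflTransGen.refl
    · push Not at hd
      obtain ⟨i, hi, hlt, hninv⟩ := hd
      have hiff := isInv_mul_swap_iff hi hlt
      refine Relation.ReflTransGen.head ⟨i, hi, hlt, rfl⟩
        (ih _ ?_ (fun a b hab => (hiff a b).2 ⟨h a b hab, ?_⟩) rfl)
      · rw [← hN]
        refine Finset.card_lt_card (Finset.ssubset_iff_of_subset ?_ |>.2
          ⟨(σ ⟨i + 1, hi⟩, σ ⟨i, Nat.lt_of_succ_lt hi⟩), ?_, ?_⟩)
        · intro x hx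
          simp only [Finset.mem_filter, Finset.mem_univ, true_and] at hx ⊢
          exact ((hiff _ _).1 hx).1
        · simp only [Finset.mem_filter, Finset.mem_univ, true_and]
          exact ⟨hlt, by simp [Fin.lt_def]⟩
        · simp [hiff]
      · rintro ⟨rfl, rfl⟩
        exact hninv hab

lemma weakLe_iff : weakLe τ σ ↔ ∀ a b, IsInv τ a b → IsInv σ a b :=
  ⟨fun h _ _ => IsInv.of_weakLe h, weakLe_of_forall_isInv⟩

lemma covRel_weakLe_iff : Ungarian.CovRel (fun a b => weakLe a b) σ τ ↔ wCov σ τ := by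
  constructor
  · rintro ⟨hle, hne, hbetween⟩
    rcases Relation.ReflTransGen.cases_head hle with rfl | ⟨c, hc, hcτ⟩
    · exact absurd rfl hne
    · rcases hbetween c hcτ (Relation.ReflTransGen.single hc) with rfl | rfl
      · exact hc
      · obtain ⟨i, hi, hlt, he⟩ := hc
        have h1 : IsInv c (c ⟨i + 1, hi⟩) (c ⟨i, Nat.lt_of_succ_lt hi⟩) :=
          ⟨hlt, by simp [Fin.lt_def]⟩
        have h2 := h1
        rw [he, isInv_mul_swap_iff hi hlt, ← he] at h2
        exact absurd ⟨rfl, rfl⟩ h2.2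
  · rintro ⟨i, hi, hlt, rfl⟩
    have hiff := isInv_mul_swap_iff hi hlt
    have hinv : IsInv σ (σ ⟨i + 1, hi⟩) (σ ⟨i, Nat.lt_of_succ_lt hi⟩) :=
      ⟨hlt, by simp [Fin.lt_def]⟩
    refine ⟨weakLe_iff.2 fun a b hab => ((hiff a b).1 hab).1, fun he => ?_, fun z h1 h2 => ?_⟩
    · have h2 := hinv
      rw [← he, hiff, he] at h2
      exact h2.2 ⟨rfl, rfl⟩
    · have h1 := weakLe_iff.1 h1
      have h2 := weakLe_iff.1 h2
      by_cases hz : IsInv z (σ ⟨i + 1, hi⟩) (σ ⟨i, Nat.lt_of_succ_lt hi⟩)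
      · refine Or.inr (eq_of_isInv_iff fun a b => ⟨h2 a b, fun hab => ?_⟩)
        by_cases hp : a = σ ⟨i + 1, hi⟩ ∧ b = σ ⟨i, Nat.lt_of_succ_lt hi⟩
        · rwa [hp.1, hp.2]
        · exact h1 a b ((hiff a b).2 ⟨hab, hp⟩)
      · refine Or.inl (eq_of_isInv_iff fun a b => ⟨fun hab => ?_, h1 a b⟩)
        refine (hiff a b).2 ⟨h2 a b hab, ?_⟩
        rintro ⟨rfl, rfl⟩
        exact hz hab

/-- The positions `j` such that `σ j > σ (j + 1)`. -/
def descents (σ : Equiv.Perm (Fin n)) : Finset (Fin n) :=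
  Finset.univ.filter fun j => ∃ h : (j : ℕ) + 1 < n, σ ⟨j + 1, h⟩ < σ j

/-- The transposition of the positions `j` and `j + 1` (the identity if `j` is the last one). -/
def adjSwap (j : Fin n) : Equiv.Perm (Fin n) :=
  if h : (j : ℕ) + 1 < n then Equiv.swap j ⟨j + 1, h⟩ else 1

lemma covFinset_weakLe (σ : Equiv.Perm (Fin n)) :
    Ungarian.covFinset (fun a b => weakLe a b) σ = (descents σ).image fun j => σ * adjSwap j := by
  ext τ
  simp only [Ungarian.covFinset, descents, covRel_weakLe_iff, Finset.mem_filter, Finset.mem_univ,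
    true_and, Finset.mem_image]
  constructor
  · rintro ⟨i, hi, hlt, rfl⟩
    exact ⟨⟨i, Nat.lt_of_succ_lt hi⟩, ⟨hi, hlt⟩, by simp [adjSwap, hi]⟩
  · rintro ⟨j, ⟨hj, hlt⟩, rfl⟩
    exact ⟨j, hj, hlt, by simp [adjSwap, hj]⟩

lemma injOn_mul_adjSwap (σ : Equiv.Perm (Fin n)) :
    Set.InjOn (fun j => σ * adjSwap j) (descents σ : Set (Fin n)) := by
  intro i hi j hj hij
  simp only [descents, Finset.coe_filter, Finset.mem_univ, true_and, Set.mem_ofPred_eq] at hi hj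
  obtain ⟨hi, -⟩ := hi
  obtain ⟨hj, -⟩ := hj
  have h1 := mul_left_cancel hij
  simp only [adjSwap, hi, hj, dif_pos] at h1
  have h2 := DFunLike.congr_fun h1 i
  have h3 := DFunLike.congr_fun h1 j
  simp only [Equiv.swap_apply_def] at h2 h3
  split_ifs at h2 h3 <;> simp only [Fin.ext_iff] at * <;> omega

/-- A greatest lower bound of `σ` and of the elements below `σ` obtained at the descents in `D`
exists, namely the permutation sorting each block of positions linked by `D`. -/
lemma exists_isMeetOf (σ : Equiv.Perm (Fin n)) {D : Finset (Fin n)} (hD : D ⊆ descents σ) :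
    ∃ m, Ungarian.IsMeetOf (fun a b => weakLe a b)
      (insert σ ((D.image fun j => σ * adjSwap j : Finset _) : Set (Equiv.Perm (Fin n)))) m := by
  let blk : Fin n → ℕ := fun j => (Finset.univ.filter fun i : Fin n => i < j ∧ i ∉ D).card
  have hblk : Monotone blk := by
    intro i j hij
    refine Finset.card_le_card fun l hl => ?_
    simp only [Finset.mem_filter, Finset.mem_univ, true_and] at hl ⊢
    exact ⟨hl.1.trans_le hij, hl.2⟩
  have hblk_lt : ∀ i j : Fin n, i < j → (∃ l, i ≤ l ∧ l < j ∧ l ∉ D) → blk i < blk j := by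
    rintro i j hij ⟨l, h1, h2, h3⟩
    refine Finset.card_lt_card (Finset.ssubset_iff_of_subset ?_ |>.2 ⟨l, ?_, ?_⟩)
    · intro l hl
      simp only [Finset.mem_filter, Finset.mem_univ, true_and] at hl ⊢
      exact ⟨hl.1.trans hij, hl.2⟩
    · simp [h2, h3]
    · simp [h1]
  let key : Fin n → ℕ ×ₗ Fin n := fun v => toLex (blk (σ.symm v), v)
  let τ : Equiv.Perm (Fin n) := Tuple.sort key
  have hkey : Function.Injective key := by
    intro v w h
    have := congrArg (fun x => (ofLex x).2) h
    simpa [key] using this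
  have hτ : StrictMono (key ∘ τ) :=
    (Tuple.monotone_sort key).strictMono_of_injective (hkey.comp τ.injective)
  have hpos : ∀ a b : Fin n, τ.symm b < τ.symm a ↔ key b < key a := by
    intro a b
    rw [← hτ.lt_iff_lt]
    simp
  have hinv : ∀ a b : Fin n, IsInv τ a b ↔ a < b ∧ blk (σ.symm b) < blk (σ.symm a) := by
    intro a b
    simp only [IsInv, hpos, key, Prod.Lex.toLex_lt_toLex]
    constructor
    · rintro ⟨h1, h2 | h2⟩
      · exact ⟨h1, h2⟩
      · exact absurd h1 h2.2.not_gt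
    · rintro ⟨h1, h2⟩
      exact ⟨h1, Or.inl h2⟩
  have hτσ : ∀ a b, IsInv τ a b → IsInv σ a b := fun a b hab => by
    rw [hinv] at hab
    exact ⟨hab.1, hblk.reflect_lt hab.2⟩
  refine ⟨τ, ?_, ?_⟩
  · intro s hs
    simp only [Finset.coe_image, Set.mem_insert_iff, Set.mem_image, Finset.mem_coe] at hs
    rcases hs with rfl | ⟨j, hj, rfl⟩
    · exact weakLe_iff.2 hτσ
    · have hjd := hD hj
      simp only [descents, Finset.mem_filter, Finset.mem_univ, true_and] at hjd
      obtain ⟨hjn, hlt⟩ := hjd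
      refine weakLe_iff.2 fun a b hab => ?_
      simp only [adjSwap, hjn, dif_pos]
      refine (isInv_mul_swap_iff hjn hlt a b).2 ⟨hτσ a b hab, ?_⟩
      rintro ⟨rfl, rfl⟩
      have h2 := ((hinv _ _).1 hab).2
      simp only [Equiv.symm_apply_apply] at h2
      refine h2.not_ge (Finset.card_le_card fun l hl => ?_)
      simp only [Finset.mem_filter, Finset.mem_univ, true_and, Fin.lt_def] at hl ⊢
      refine ⟨?_, hl.2⟩
      have : (l : ℕ) ≠ j := fun h => hl.2 (Fin.ext h ▸ hj)
      omega
  · intro z hz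
    refine weakLe_iff.2 fun a b hab => ?_
    have hσ := weakLe_iff.1 (hz σ (by simp)) a b hab
    refine (hinv a b).2 ⟨hab.1, ?_⟩
    by_contra hcon
    have hall : ∀ l, σ.symm b ≤ l → l < σ.symm a → l ∈ D := by
      intro l h1 h2
      by_contra hl
      exact hcon (hblk_lt _ _ hσ.2 ⟨l, h1, h2, hl⟩)
    have hchain : n - (z.symm (σ (σ.symm b)) : ℕ) < n - (z.symm (σ (σ.symm a)) : ℕ) := by
      refine lt_of_forall_lt_succ (f := fun i => n - (z.symm (σ i) : ℕ)) hσ.2 fun l hl h1 h2 => ?_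
      have hlD := hall ⟨l, Nat.lt_of_succ_lt hl⟩ h1 h2
      have hld := hD hlD
      simp only [descents, Finset.mem_filter, Finset.mem_univ, true_and] at hld
      obtain ⟨_, hlt⟩ := hld
      have hle := weakLe_iff.1 (hz (σ * adjSwap ⟨l, Nat.lt_of_succ_lt hl⟩) (by
        simp only [Finset.coe_image, Set.mem_insert_iff, Set.mem_image, Finset.mem_coe]
        exact Or.inr ⟨_, hlD, rfl⟩)) (σ ⟨l + 1, hl⟩) (σ ⟨l, Nat.lt_of_succ_lt hl⟩)
      simp only [adjSwap, hl, dif_pos, isInv_mul_swap_iff hl hlt] at hle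
      have hn : ¬ IsInv z (σ ⟨l + 1, hl⟩) (σ ⟨l, Nat.lt_of_succ_lt hl⟩) :=
        fun h => absurd (hle h).2 (by simp)
      have hne : z.symm (σ ⟨l + 1, hl⟩) ≠ z.symm (σ ⟨l, Nat.lt_of_succ_lt hl⟩) :=
        fun h => hlt.ne (z.symm.injective h)
      have hge : z.symm (σ ⟨l + 1, hl⟩) ≤ z.symm (σ ⟨l, Nat.lt_of_succ_lt hl⟩) :=
        not_lt.1 fun h => hn ⟨hlt, h⟩
      have := lt_of_le_of_ne hge hne
      rw [Fin.lt_def] at this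
      have := (z.symm (σ ⟨l, Nat.lt_of_succ_lt hl⟩)).2
      omega
    simp only [Equiv.apply_symm_apply] at hchain
    have := hab.2
    rw [Fin.lt_def] at this
    omega

lemma isInv_meetOf (σ : Equiv.Perm (Fin n)) {D : Finset (Fin n)} (hD : D ⊆ descents σ)
    {a b : Fin n}
    (h : IsInv (Ungarian.meetOf (fun a b => weakLe a b) σ (D.image fun j => σ * adjSwap j)) a b) :
    IsInv σ a b ∧ ∀ j ∈ D, ∀ hj : (j : ℕ) + 1 < n, ¬ (a = σ ⟨j + 1, hj⟩ ∧ b = σ j) := by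
  have hex := exists_isMeetOf σ hD
  rw [Ungarian.meetOf, dif_pos hex] at h
  have hlow := hex.choose_spec.1
  refine ⟨weakLe_iff.1 (hlow σ (by simp)) a b h, fun j hj hjn => ?_⟩
  have hjd := hD hj
  simp only [descents, Finset.mem_filter, Finset.mem_univ, true_and] at hjd
  obtain ⟨_, hlt⟩ := hjd
  have := weakLe_iff.1 (hlow (σ * adjSwap j) (by
    simp only [Finset.coe_image, Set.mem_insert_iff, Set.mem_image, Finset.mem_coe]
    exact Or.inr ⟨j, hj, rfl⟩)) a b h
  simp only [adjSwap, hjn, dif_pos] at this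
  exact ((isInv_mul_swap_iff hjn hlt a b).1 this).2

end WeakOrder

/-- The number of customers (`0` or `1`) leaving a queue of length `g`; `b` says whether the
server is active. -/
def served (g : ℕ) (b : Prop) : ℕ := if b ∧ 0 < g then 1 else 0

/-- One time step of a series of queues with `a` external arrivals: the new queue lengths. -/
def queueStep : List ℕ → ℕ → (ℕ → Prop) → List ℕ
  | [], _, _ => []
  | g :: gs, a, b => (g - served g (b 0) + a) :: queueStep gs (served g (b 0)) fun i => b (i + 1)

/-- One time step of a series of queues with `a` external arrivals: the number of departures from
the last queue. -/
def queueOut : List ℕ → ℕ → (ℕ → Prop) → ℕ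
  | [], a, _ => a
  | g :: gs, _, b => queueOut gs (served g (b 0)) fun i => b (i + 1)

lemma served_le (g : ℕ) (b : Prop) : served g b ≤ g := by
  unfold served
  split_ifs with h
  · exact h.2
  · exact Nat.zero_le _

lemma served_le_ite (g : ℕ) (b : Prop) : served g b ≤ if b then 1 else 0 := by
  unfold served
  split_ifs <;> simp_all

lemma length_queueStep (gs : List ℕ) (a : ℕ) (b : ℕ → Prop) :
    (queueStep gs a b).length = gs.length := by
  induction gs generalizing a b with
  | nil => rfl
  | cons g gs ih => simp [queueStep, ih]

lemma sum_queueStep_add_queueOut (gs : List ℕ) (a : ℕ) (b : ℕ → Prop) :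
    (queueStep gs a b).sum + queueOut gs a b = gs.sum + a := by
  induction gs generalizing a b with
  | nil => simp [queueStep, queueOut]
  | cons g gs ih =>
    have h1 := ih (served g (b 0)) fun i => b (i + 1)
    have h2 := served_le g (b 0)
    simp only [queueStep, queueOut, List.sum_cons]
    omega

lemma sum_drop_queueStep_le (gs : List ℕ) (a : ℕ) (b : ℕ → Prop) {i : ℕ} (hi : i < gs.length) :
    ((queueStep gs a b).drop (i + 1)).sum + queueOut gs a b ≤
      (gs.drop (i + 1)).sum + if b i then 1 else 0 := by
  induction gs generalizing a b i with
  | nil => simp at hi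
  | cons g gs ih =>
    simp only [queueStep, queueOut, List.drop_succ_cons]
    cases i with
    | zero =>
      have h1 := sum_queueStep_add_queueOut gs (served g (b 0)) fun i => b (i + 1)
      have h2 := served_le_ite g (b 0)
      simp only [List.drop_zero]
      omega
    | succ i => exact ih _ (fun i => b (i + 1)) (by simpa using hi)

lemma sum_drop_succ_queueStep_le (gs : List ℕ) (a : ℕ) (b : ℕ → Prop) {i : ℕ}
    (hi : i + 1 < gs.length) :
    ((queueStep gs a b).drop (i + 2)).sum + queueOut gs a b ≤ (gs.drop (i + 1)).sum := by
  induction gs generalizing a b i with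
  | nil => simp at hi
  | cons g gs ih =>
    simp only [queueStep, queueOut, List.drop_succ_cons]
    cases i with
    | zero =>
      cases gs with
      | nil => simp at hi
      | cons g' gs =>
        have h1 := sum_queueStep_add_queueOut gs (served g' (b 1)) fun i => b (i + 2)
        have h2 := served_le g' (b 1)
        simp only [queueStep, queueOut, List.drop_succ_cons, List.drop_zero, List.sum_cons,
          zero_add, add_assoc, one_add_one_eq_two] at h1 ⊢
        omega
    | succ i => exact ih _ _ (by simpa using hi)

/-- Average over lists of `m` independent entries with weights `w`. -/
def listAvg (w : ℕ → ℝ≥0∞) : ℕ → (List ℕ → ℝ≥0∞) → ℝ≥0∞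
  | 0, f => f []
  | m + 1, f => ∑' g, w g * listAvg w m fun l => f (g :: l)

section ListAvg

variable {w : ℕ → ℝ≥0∞}

lemma listAvg_mono {m : ℕ} {f f' : List ℕ → ℝ≥0∞} (h : ∀ l, l.length = m → f l ≤ f' l) :
    listAvg w m f ≤ listAvg w m f' := by
  induction m generalizing f f' with
  | zero => exact h [] rfl
  | succ m ih =>
    refine ENNReal.tsum_le_tsum fun g => ?_
    gcongr
    exact ih fun l hl => h _ (by simp [hl])

lemma listAvg_add (m : ℕ) (f f' : List ℕ → ℝ≥0∞) :
    listAvg w m (fun l => f l + f' l) = listAvg w m f + listAvg w m f' := by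
  induction m generalizing f f' with
  | zero => rfl
  | succ m ih => simp only [listAvg, ih, mul_add, ENNReal.tsum_add]

lemma listAvg_const_mul (m : ℕ) (c : ℝ≥0∞) (f : List ℕ → ℝ≥0∞) :
    listAvg w m (fun l => c * f l) = c * listAvg w m f := by
  induction m generalizing f with
  | zero => rfl
  | succ m ih => simp only [listAvg, ih, mul_left_comm _ c, ENNReal.tsum_mul_left]

lemma listAvg_pow_sum (m : ℕ) (x : ℝ≥0∞) :
    listAvg w m (fun l => x ^ l.sum) = (∑' g, w g * x ^ g) ^ m := by
  induction m with
  | zero => simp [listAvg]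
  | succ m ih =>
    simp only [listAvg, List.sum_cons, pow_add, listAvg_const_mul, ih, ← mul_assoc,
      ENNReal.tsum_mul_right]
    ring

lemma listAvg_const (hw : ∑' g, w g = 1) (m : ℕ) (c : ℝ≥0∞) :
    listAvg w m (fun _ => c) = c := by
  have h := listAvg_pow_sum (w := w) m 1
  simp only [one_pow, mul_one, hw] at h
  simpa [h] using listAvg_const_mul (w := w) m c fun _ => 1

end ListAvg

/-- The stationary weights of a queue: `r` for the empty one, `c * r ^ g` for length `g + 1`. -/
def gapWeight (r c : ℝ≥0∞) : ℕ → ℝ≥0∞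
  | 0 => r
  | g + 1 => c * r ^ g

/-- Average of `f` (new lengths, departures) over one step of the queues `gs` with `a` arrivals and
servers active with weight `P`. -/
def tandem (P Q : ℝ≥0∞) (f : List ℕ → ℕ → ℝ≥0∞) (gs : List ℕ) (a : ℕ) : ℝ≥0∞ :=
  subsetAvg P Q (Finset.range gs.length) fun ξ =>
    f (queueStep gs a (· ∈ ξ)) (queueOut gs a (· ∈ ξ))

/-- Value after `t` steps, from queues `gs` and past departures `y`, of the function `h` of the
total number of departures, for arrivals of weight `α` and servers of weight `P`. -/
def tandemVal (P Q α β : ℝ≥0∞) (h : ℝ → ℝ≥0∞) : ℕ → ℝ → List ℕ → ℝ≥0∞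
  | 0, y, _ => h y
  | t + 1, y, gs =>
    β * tandem P Q (fun l d => tandemVal P Q α β h t (y + d) l) gs 0 +
      α * tandem P Q (fun l d => tandemVal P Q α β h t (y + d) l) gs 1

section Burke

variable {P Q α β r c : ℝ≥0∞}

lemma tandem_cons (f : List ℕ → ℕ → ℝ≥0∞) (g : ℕ) (gs : List ℕ) (a : ℕ) :
    tandem P Q f (g :: gs) a =
      Q * tandem P Q (fun l d => f ((g + a) :: l) d) gs 0 +
      P * tandem P Q (fun l d => f ((g - served g True + a) :: l) d) gs (served g True) := by
  unfold tandem
  rw [List.length_cons, subsetAvg_range_succ]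
  simp [queueStep, queueOut, served]

/-- Burke's theorem for one queue. -/
lemma tsum_gapWeight_mul (hPQ : Q + P = 1) (h1 : c * P * β = r * α)
    (h2 : r * α + c * Q * β = c * β) (h3 : Q * α + r * Q * β = r * β)
    (h4 : P * α + r * P * β = α) (H : ℕ → ℕ → ℝ≥0∞) :
    ∑' g, gapWeight r c g * (β * (Q * H g 0 + P * H (g - served g True) (served g True)) +
      α * (Q * H (g + 1) 0 + P * H (g - served g True + 1) (served g True))) =
    ∑' g, gapWeight r c g * (β * H g 0 + α * H g 1) := by
  have hl : ∀ g, gapWeight r c (g + 1) * (β * (Q * H (g + 1) 0 +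
      P * H (g + 1 - served (g + 1) True) (served (g + 1) True)) +
      α * (Q * H (g + 1 + 1) 0 +
        P * H (g + 1 - served (g + 1) True + 1) (served (g + 1) True))) =
      c * r ^ g * Q * β * H (g + 1) 0 + c * r ^ g * P * β * H g 1 +
        (c * r ^ g * Q * α * H (g + 2) 0 + c * r ^ g * P * α * H (g + 1) 1) := by
    intro g
    simp only [gapWeight, served, true_and, Nat.succ_pos, if_true, Nat.add_sub_cancel]
    ring
  have hr : ∀ g, gapWeight r c (g + 1) * (β * H (g + 1) 0 + α * H (g + 1) 1) =
      c * r ^ g * β * H (g + 1) 0 + c * r ^ g * α * H (g + 1) 1 := by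
    intro g
    simp only [gapWeight]
    ring
  rw [tsum_eq_zero_add' ENNReal.summable,
    tsum_eq_zero_add' (f := fun g => gapWeight r c g * (β * H g 0 + α * H g 1)) ENNReal.summable]
  simp only [hl, hr, ENNReal.tsum_add]
  rw [tsum_eq_zero_add' (f := fun g => c * r ^ g * Q * β * H (g + 1) 0) ENNReal.summable,
    tsum_eq_zero_add' (f := fun g => c * r ^ g * P * β * H g 1) ENNReal.summable,
    tsum_eq_zero_add' (f := fun g => c * r ^ g * β * H (g + 1) 0) ENNReal.summable]
  simp only [gapWeight, served, true_and, lt_irrefl, if_false, pow_zero, mul_one, zero_add,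
    Nat.sub_zero]
  have e1 : r * (β * (Q * H 0 0 + P * H 0 0) + α * (Q * H 1 0 + P * H 1 0)) =
      r * β * H 0 0 + r * α * H 1 0 := by
    calc _ = (Q + P) * (r * β * H 0 0 + r * α * H 1 0) := by ring
      _ = _ := by rw [hPQ, one_mul]
  have e2 : ∑' g, c * r ^ (g + 1) * Q * β * H (g + 1 + 1) 0 +
      ∑' g, c * r ^ g * Q * α * H (g + 2) 0 =
      ∑' g, c * r ^ (g + 1) * β * H (g + 1 + 1) 0 := by
    rw [← ENNReal.tsum_add]
    refine tsum_congr fun g => ?_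
    calc _ = (Q * α + r * Q * β) * (c * r ^ g * H (g + 2) 0) := by ring
      _ = _ := by rw [h3]; ring
  have e3 : ∑' g, c * r ^ (g + 1) * P * β * H (g + 1) 1 + ∑' g, c * r ^ g * P * α * H (g + 1) 1 =
      ∑' g, c * r ^ g * α * H (g + 1) 1 := by
    rw [← ENNReal.tsum_add]
    refine tsum_congr fun g => ?_
    calc _ = (P * α + r * P * β) * (c * r ^ g * H (g + 1) 1) := by ring
      _ = _ := by rw [h4]; ring
  rw [e1, ← e2, ← e3, h1, ← h2]
  ring

/-- Burke's theorem for queues in series. -/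
lemma listAvg_tandem (hPQ : Q + P = 1) (h1 : c * P * β = r * α)
    (h2 : r * α + c * Q * β = c * β) (h3 : Q * α + r * Q * β = r * β)
    (h4 : P * α + r * P * β = α) (m : ℕ) (f : List ℕ → ℕ → ℝ≥0∞) :
    listAvg (gapWeight r c) m (fun l => β * tandem P Q f l 0 + α * tandem P Q f l 1) =
      listAvg (gapWeight r c) m (fun l => β * f l 0 + α * f l 1) := by
  induction m generalizing f with
  | zero => simp [listAvg, tandem, subsetAvg_empty, queueStep, queueOut]
  | succ m ih =>
    simp only [listAvg, tandem_cons, listAvg_add, listAvg_const_mul] at ih ⊢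
    have := tsum_gapWeight_mul hPQ h1 h2 h3 h4 fun g d =>
      listAvg (gapWeight r c) m fun l => tandem P Q (fun l d => f (g :: l) d) l d
    simp only [add_zero] at this ⊢
    rw [this]
    exact tsum_congr fun g => by rw [ih fun l d => f (g :: l) d]

lemma listAvg_tandemVal (hPQ : Q + P = 1) (h1 : c * P * β = r * α)
    (h2 : r * α + c * Q * β = c * β) (h3 : Q * α + r * Q * β = r * β)
    (h4 : P * α + r * P * β = α) (hw : ∑' g, gapWeight r c g = 1) {h : ℝ → ℝ≥0∞} {x : ℝ≥0∞}
    (hh : ∀ y, h (y + 1) = x * h y) (m t : ℕ) (y : ℝ) :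
    listAvg (gapWeight r c) m (tandemVal P Q α β h t y) = h y * (β + α * x) ^ t := by
  induction t generalizing y with
  | zero => simp [tandemVal, listAvg_const hw]
  | succ t ih =>
    simp only [tandemVal]
    rw [listAvg_tandem hPQ h1 h2 h3 h4, listAvg_add, listAvg_const_mul, listAvg_const_mul]
    simp only [Nat.cast_zero, Nat.cast_one, add_zero]
    rw [ih, ih, hh]
    ring

end Burke

section Threshold

variable {n : ℕ}

/-- The values at least `k`. -/
def highValues (n k : ℕ) : Finset (Fin n) := Finset.univ.filter fun b => k ≤ (b : ℕ)

/-- The values less than `k`. -/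
def lowValues (n k : ℕ) : Finset (Fin n) := Finset.univ.filter fun a => (a : ℕ) < k

/-- The values less than `k` standing before the value `b` in `σ`. -/
def lowBefore (k : ℕ) (σ : Equiv.Perm (Fin n)) (b : Fin n) : Finset (Fin n) :=
  (lowValues n k).filter fun a => σ.symm a < σ.symm b

/-- The number of values at least `k` standing after the value `b` in `σ`. -/
def highRank (k : ℕ) (σ : Equiv.Perm (Fin n)) (b : Fin n) : ℕ :=
  ((highValues n k).filter fun c => σ.symm b < σ.symm c).card

/-- In `σ` the values less than `k` are not all before those at least `k`. -/
def Unsorted (k : ℕ) (σ : Equiv.Perm (Fin n)) : Prop :=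
  ∃ b ∈ highValues n k, (lowBefore k σ b).card < (lowValues n k).card

/-- Each value at least `k` has been passed in `σ` by as many values less than `k` as the
corresponding queue of the system with queue lengths `gs` and `y` departures has served. -/
def Dominates (k : ℕ) (σ : Equiv.Perm (Fin n)) (y : ℝ) (gs : List ℕ) : Prop :=
  ∀ b ∈ highValues n k,
    min ((lowValues n k).card : ℝ) (y + (gs.drop (highRank k σ b + 1)).sum) ≤
      (lowBefore k σ b).card

variable {k : ℕ} {σ τ : Equiv.Perm (Fin n)}

lemma highRank_lt {b c : Fin n} (hc : c ∈ highValues n k) (h : σ.symm b < σ.symm c) :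
    highRank k σ c < highRank k σ b := by
  refine Finset.card_lt_card (Finset.ssubset_iff_of_subset ?_ |>.2 ⟨c, ?_, ?_⟩)
  · intro x hx
    simp only [Finset.mem_filter] at hx ⊢
    exact ⟨hx.1, h.trans hx.2⟩
  · simp [hc, h]
  · simp

lemma highRank_injOn : Set.InjOn (highRank k σ) (highValues n k : Set (Fin n)) := by
  intro b hb c hc h
  rcases lt_trichotomy (σ.symm b) (σ.symm c) with hlt | heq | hgt
  · exact absurd h (highRank_lt hc hlt).ne'
  · exact σ.symm.injective heq
  · exact absurd h (highRank_lt hb hgt).ne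

lemma highRank_lt_card {b : Fin n} (hb : b ∈ highValues n k) :
    highRank k σ b < (highValues n k).card := by
  refine Finset.card_lt_card (Finset.ssubset_iff_of_subset (Finset.filter_subset _ _) |>.2
    ⟨b, hb, by simp⟩)

lemma image_highRank : (highValues n k).image (highRank k σ) =
    Finset.range (highValues n k).card := by
  refine Finset.eq_of_subset_of_card_le (fun i hi => ?_) ?_
  · obtain ⟨b, hb, rfl⟩ := Finset.mem_image.1 hi
    exact Finset.mem_range.2 (highRank_lt_card hb)
  · rw [Finset.card_image_of_injOn highRank_injOn, Finset.card_range]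

lemma exists_highRank_le (σ τ : Equiv.Perm (Fin n)) {b : Fin n} (hb : b ∈ highValues n k) :
    ∃ c ∈ highValues n k, highRank k σ c ≤ highRank k τ b ∧
      highRank k τ b ≤ highRank k τ c := by
  set i := highRank k τ b with hi
  have him : i < (highValues n k).card := highRank_lt_card hb
  have h1 : i + 1 ≤ ((highValues n k).filter fun c => highRank k σ c ≤ i).card := by
    rw [← Finset.card_range (i + 1)]
    refine (Finset.card_le_card fun j hj => ?_).trans
      (Finset.card_image_le (f := highRank k σ))
    have hj' : j ≤ i := Nat.lt_succ_iff.1 (Finset.mem_range.1 hj)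
    have : j ∈ (highValues n k).image (highRank k σ) := by
      rw [image_highRank]
      exact Finset.mem_range.2 (hj'.trans_lt him)
    obtain ⟨c, hc, rfl⟩ := Finset.mem_image.1 this
    exact Finset.mem_image.2 ⟨c, Finset.mem_filter.2 ⟨hc, hj'⟩, rfl⟩
  have h2 : ((highValues n k).filter fun c => highRank k τ c < i).card ≤ i := by
    rw [← Finset.card_image_of_injOn ((highRank_injOn (k := k) (σ := τ)).mono
      (Finset.coe_subset.2 (Finset.filter_subset _ _)))]
    refine (Finset.card_le_card (t := Finset.range i) fun j hj => ?_).trans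
      (Finset.card_range i).le
    obtain ⟨c, hc, rfl⟩ := Finset.mem_image.1 hj
    exact Finset.mem_range.2 (Finset.mem_filter.1 hc).2
  obtain ⟨c, hc1, hc2⟩ := Finset.exists_mem_notMem_of_card_lt_card
    (h2.trans_lt (Nat.lt_of_succ_le h1))
  simp only [Finset.mem_filter] at hc1 hc2
  exact ⟨c, hc1.1, hc1.2, not_lt.1 fun h => hc2 ⟨hc1.1, h⟩⟩

lemma lowBefore_subset_of_isInv (h : ∀ a b, IsInv τ a b → IsInv σ a b) {b : Fin n}
    (hb : b ∈ highValues n k) : lowBefore k σ b ⊆ lowBefore k τ b := by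
  intro a ha
  simp only [lowBefore, lowValues, highValues, Finset.mem_filter, Finset.mem_univ,
    true_and] at ha hb ⊢
  refine ⟨ha.1, ?_⟩
  have hab : a < b := Fin.lt_def.2 (ha.1.trans_le hb)
  by_contra hcon
  have hne : τ.symm b ≠ τ.symm a := fun he => hab.ne' (τ.symm.injective he)
  exact ha.2.not_gt (h a b ⟨hab, lt_of_le_of_ne (not_lt.1 hcon) hne⟩).2

lemma Dominates.queueStep {y : ℝ} {gs : List ℕ} (hdom : Dominates k σ y gs)
    (hgs : gs.length = (highValues n k).card) (a : ℕ) {B : Finset (Fin n)} {ξ : Finset ℕ}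
    (hinv : ∀ a b, IsInv τ a b → IsInv σ a b ∧
      ∀ j ∈ B, ∀ hj : (j : ℕ) + 1 < n, ¬ (a = σ ⟨j + 1, hj⟩ ∧ b = σ j))
    (hξ : ∀ j, σ j ∈ highValues n k → j ∈ descents σ → highRank k σ (σ j) ∈ ξ → j ∈ B) :
    Dominates k τ (y + queueOut gs a (· ∈ ξ)) (queueStep gs a (· ∈ ξ)) := by
  have hdrop : ∀ (l : List ℕ) (i j : ℕ), i ≤ j → (l.drop j).sum ≤ (l.drop i).sum := by
    intro l i j hij
    obtain ⟨d, rfl⟩ := Nat.exists_eq_add_of_le hij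
    rw [← List.drop_drop]
    exact (List.drop_sublist _ _).sum_le_sum fun _ _ => Nat.zero_le _
  have hsub : ∀ b ∈ highValues n k, lowBefore k σ b ⊆ lowBefore k τ b := fun b hb =>
    lowBefore_subset_of_isInv (fun a b h => (hinv a b h).1) hb
  intro b' hb'
  obtain ⟨b, hb, hb1, hb2⟩ := exists_highRank_le σ τ hb'
  have hpos : τ.symm b ≤ τ.symm b' := not_lt.1 fun h => (highRank_lt hb h).not_ge hb2
  have hbb' : (lowBefore k τ b).card ≤ (lowBefore k τ b').card := by
    refine Finset.card_le_card fun x hx => ?_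
    simp only [lowBefore, Finset.mem_filter] at hx ⊢
    exact ⟨hx.1, hx.2.trans_le hpos⟩
  set gs' := _root_.queueStep gs a (· ∈ ξ) with hgs'
  set d := queueOut gs a (· ∈ ξ) with hd
  suffices hmain : min ((lowValues n k).card : ℝ) (y + d + (gs'.drop (highRank k σ b + 1)).sum) ≤
      (lowBefore k τ b).card by
    refine le_trans (min_le_min_left _ ?_) (hmain.trans (by exact_mod_cast hbb'))
    have := hdrop gs' _ _ (Nat.succ_le_succ hb1)
    have : ((gs'.drop (highRank k τ b' + 1)).sum : ℝ) ≤ (gs'.drop (highRank k σ b + 1)).sum := by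
      exact_mod_cast this
    linarith
  have hcard := Finset.card_le_card (hsub b hb)
  have hlen : highRank k σ b < gs.length := hgs ▸ highRank_lt_card hb
  have hdomb := hdom b hb
  have hstep := sum_drop_queueStep_le gs a (· ∈ ξ) hlen
  rw [← hgs', ← hd] at hstep
  obtain ⟨j, rfl⟩ := σ.surjective b
  by_cases hj : (j : ℕ) + 1 < n
  · by_cases hc : σ ⟨j + 1, hj⟩ ∈ highValues n k
    · have hlt : σ.symm (σ j) < σ.symm (σ ⟨j + 1, hj⟩) := by simp [Fin.lt_def]
      have hrank := highRank_lt hc hlt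
      have hlow : (lowBefore k σ (σ ⟨j + 1, hj⟩)).card ≤ (lowBefore k σ (σ j)).card := by
        refine Finset.card_le_card fun x hx => ?_
        simp only [lowBefore, lowValues, highValues, Finset.mem_filter, Finset.mem_univ, true_and,
          Equiv.symm_apply_apply, Fin.lt_def] at hx hb ⊢
        refine ⟨hx.1, lt_of_le_of_ne (Nat.lt_succ_iff.1 hx.2) fun he => ?_⟩
        have : x = σ j := by rw [← Fin.ext he, Equiv.apply_symm_apply]
        omega
      obtain ⟨i, hi⟩ : ∃ i, highRank k σ (σ j) = i + 1 :=
        ⟨highRank k σ (σ j) - 1, by omega⟩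
      rw [hi] at hlen hrank ⊢
      have h1 := sum_drop_succ_queueStep_le gs a (· ∈ ξ) hlen
      rw [← hgs', ← hd] at h1
      have h2 := hdrop gs _ _ (Nat.lt_succ_iff.1 hrank |> Nat.succ_le_succ)
      have h3 : ((gs'.drop (i + 1 + 1)).sum : ℝ) + d ≤
          (gs.drop (highRank k σ (σ ⟨j + 1, hj⟩) + 1)).sum := by
        exact_mod_cast h1.trans h2
      refine le_trans (min_le_min_left _ (by linarith)) ((hdom _ hc).trans ?_)
      exact_mod_cast hlow.trans hcard
    · have hcb : σ ⟨j + 1, hj⟩ < σ j := by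
        simp only [highValues, Finset.mem_filter, Finset.mem_univ, true_and] at hc hb
        rw [Fin.lt_def]
        omega
      have hjd : j ∈ descents σ := by
        simp only [descents, Finset.mem_filter, Finset.mem_univ, true_and]
        exact ⟨hj, hcb⟩
      by_cases hjξ : highRank k σ (σ j) ∈ ξ
      · have hjB := hξ j hb hjd hjξ
        have hlt : (lowBefore k σ (σ j)).card < (lowBefore k τ (σ j)).card := by
          refine Finset.card_lt_card (Finset.ssubset_iff_of_subset (hsub _ hb) |>.2
            ⟨σ ⟨j + 1, hj⟩, ?_, ?_⟩)
          · simp only [lowBefore, lowValues, highValues, Finset.mem_filter, Finset.mem_univ,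
              true_and, not_le] at hc ⊢
            refine ⟨hc, ?_⟩
            by_contra hcon
            have hne : τ.symm (σ j) ≠ τ.symm (σ ⟨j + 1, hj⟩) :=
              fun he => hcb.ne' (τ.symm.injective he)
            exact (hinv _ _ ⟨hcb, lt_of_le_of_ne (not_lt.1 hcon) hne⟩).2 j hjB hj ⟨rfl, rfl⟩
          · intro hm
            have := (Finset.mem_filter.1 hm).2
            simp [Fin.lt_def] at this
        have h1 : ((lowBefore k σ (σ j)).card : ℝ) + 1 ≤ (lowBefore k τ (σ j)).card := by
          exact_mod_cast hlt
        have h2 : ((gs'.drop (highRank k σ (σ j) + 1)).sum : ℝ) + d ≤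
            (gs.drop (highRank k σ (σ j) + 1)).sum + 1 := by
          rw [if_pos hjξ] at hstep
          exact_mod_cast hstep
        rcases min_le_iff.1 hdomb with h | h
        · exact (min_le_left _ _).trans (by linarith)
        · exact (min_le_right _ _).trans (by linarith)
      · have h2 : ((gs'.drop (highRank k σ (σ j) + 1)).sum : ℝ) + d ≤
            (gs.drop (highRank k σ (σ j) + 1)).sum := by
          rw [if_neg hjξ] at hstep
          exact_mod_cast hstep
        refine le_trans (min_le_min_left _ (by linarith)) (hdomb.trans ?_)
        exact_mod_cast hcard
  · refine (min_le_left _ _).trans ?_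
    refine Nat.cast_le.2 ((Finset.card_le_card fun x hx => ?_).trans hcard)
    simp only [lowBefore, lowValues, highValues, Finset.mem_filter, Finset.mem_univ, true_and,
      Equiv.symm_apply_apply, Fin.lt_def] at hx hb ⊢
    have hne : (σ.symm x : ℕ) ≠ j := fun he => by
      have : x = σ j := by rw [← Fin.ext he, Equiv.apply_symm_apply]
      omega
    have := (σ.symm x).2
    exact ⟨hx, by omega⟩

lemma one_le_of_unsorted {y : ℝ} {gs : List ℕ} (hdom : Dominates k σ y gs) (h : Unsorted k σ) :
    y < (lowValues n k).card := by
  obtain ⟨b, hb, hlt⟩ := h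
  have h1 : ((lowBefore k σ b).card : ℝ) < (lowValues n k).card := by exact_mod_cast hlt
  rcases min_le_iff.1 (hdom b hb) with h2 | h2
  · linarith
  · have : (0 : ℝ) ≤ (gs.drop (highRank k σ b + 1)).sum := Nat.cast_nonneg _
    linarith

lemma exists_unsorted (h : σ ≠ 1) : ∃ k < n, Unsorted k σ := by
  by_contra! hcon
  refine h (eq_of_isInv_iff fun a b => ⟨fun hab => ?_, fun hab => ?_⟩)
  · refine absurd ⟨b, by simp [highValues], Finset.card_lt_card
      (Finset.ssubset_iff_of_subset (Finset.filter_subset _ _) |>.2 ⟨a, ?_, ?_⟩)⟩ (hcon b b.2)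
    · simpa [lowValues] using hab.1
    · exact fun hm => (Finset.mem_filter.1 hm).2.not_gt hab.2
  · exact absurd hab.2 hab.1.not_gt

lemma stepOp_iterate_le_tandemVal {p : ℝ}
    (hPQ : ENNReal.ofReal (1 - p) + ENNReal.ofReal p = 1) {α β : ℝ≥0∞} (hαβ : β + α = 1)
    {h : ℝ → ℝ≥0∞} (hh : ∀ y : ℝ, y < (lowValues n k).card → 1 ≤ h y) (t : ℕ) {y : ℝ}
    {gs : List ℕ} (hgs : gs.length = (highValues n k).card) (hdom : Dominates k σ y gs) :
    (stepOp p fun a b => weakLe a b)^[t] (fun σ => if Unsorted k σ then 1 else 0) σ ≤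
      tandemVal (ENNReal.ofReal p) (ENNReal.ofReal (1 - p)) α β h t y gs := by
  induction t generalizing σ y gs with
  | zero =>
    simp only [Function.iterate_zero, id, tandemVal]
    split_ifs with hu
    · exact hh y (one_le_of_unsorted hdom hu)
    · exact zero_le
  | succ t ih =>
    rw [Function.iterate_succ_apply']
    have key : ∀ a, stepOp p (fun a b => weakLe a b) ((stepOp p fun a b => weakLe a b)^[t]
        (fun σ => if Unsorted k σ then 1 else 0)) σ ≤
        tandem (ENNReal.ofReal p) (ENNReal.ofReal (1 - p)) (fun l d =>
          tandemVal (ENNReal.ofReal p) (ENNReal.ofReal (1 - p)) α β h t (y + d) l) gs a := by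
      intro a
      set J := Finset.univ.filter fun j => σ j ∈ highValues n k with hJ
      have hrange : Finset.range gs.length = J.image fun j => highRank k σ (σ j) := by
        rw [hgs, ← image_highRank (σ := σ)]
        ext i
        simp only [Finset.mem_image, hJ, Finset.mem_filter, Finset.mem_univ, true_and]
        constructor
        · rintro ⟨b, hb, rfl⟩
          exact ⟨σ.symm b, by simpa using hb, by simp⟩
        · rintro ⟨j, hj, rfl⟩
          exact ⟨σ j, hj, rfl⟩
      have hinj : Set.InjOn (fun j => highRank k σ (σ j)) (J : Set (Fin n)) := by
        intro i hi j hj hij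
        simp only [hJ, Finset.coe_filter, Finset.mem_univ, true_and, Set.mem_ofPred_eq] at hi hj
        exact σ.injective (highRank_injOn hi hj hij)
      unfold stepOp tandem
      rw [covFinset_weakLe, subsetAvg_image (injOn_mul_adjSwap σ),
        ← subsetAvg_inter_of_subset hPQ (Finset.subset_univ (descents σ)), hrange,
        subsetAvg_image hinj, ← subsetAvg_inter_of_subset hPQ (Finset.subset_univ J)]
      refine subsetAvg_mono fun B _ => ih ((length_queueStep _ _ _).trans hgs) ?_
      refine hdom.queueStep hgs a
        (fun a b hab => isInv_meetOf σ Finset.inter_subset_right hab) fun j hj hjd hjξ => ?_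
      obtain ⟨i, hi, hij⟩ := Finset.mem_image.1 hjξ
      rw [Finset.mem_inter] at hi
      have := hinj hi.2 (by simp [hJ, hj]) hij
      exact Finset.mem_inter.2 ⟨this ▸ hi.1, hjd⟩
    calc _ = (β + α) * stepOp p (fun a b => weakLe a b) ((stepOp p fun a b => weakLe a b)^[t]
          (fun σ => if Unsorted k σ then 1 else 0)) σ := by rw [hαβ, one_mul]
      _ ≤ _ := by
        rw [add_mul, tandemVal]
        gcongr
        · exact key 0
        · exact key 1

end Threshold

section Bounds

lemma tsum_gapWeight_mul_pow {R C X : ℝ} (hR : 0 ≤ R) (hC : 0 ≤ C) (hX : 0 ≤ X) (h : R * X < 1) :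
    ∑' g, gapWeight (ENNReal.ofReal R) (ENNReal.ofReal C) g * ENNReal.ofReal X ^ g =
      ENNReal.ofReal (R + C * X / (1 - R * X)) := by
  rw [tsum_eq_zero_add' ENNReal.summable]
  have e : ∀ g, gapWeight (ENNReal.ofReal R) (ENNReal.ofReal C) (g + 1) *
      ENNReal.ofReal X ^ (g + 1) = ENNReal.ofReal (C * X) * ENNReal.ofReal (R * X) ^ g := by
    intro g
    simp only [gapWeight]
    rw [ENNReal.ofReal_mul hC, ENNReal.ofReal_mul hR]
    ring
  rw [tsum_congr e, ENNReal.tsum_mul_left, ENNReal.tsum_geometric, gapWeight, pow_zero, mul_one]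
  rw [← ENNReal.ofReal_one, ← ENNReal.ofReal_sub _ (mul_nonneg hR hX),
    ← ENNReal.ofReal_inv_of_pos (sub_pos.2 h), ← ENNReal.ofReal_mul (mul_nonneg hC hX),
    ← ENNReal.ofReal_add hR, div_eq_mul_inv]
  exact mul_nonneg (mul_nonneg hC hX) (inv_nonneg.2 (sub_pos.2 h).le)

lemma eventually_pos_of_hasDerivAt {f : ℝ → ℝ} {f' : ℝ} (hf : HasDerivAt f f' 0) (h0 : f 0 = 0)
    (hf' : 0 < f') : ∀ᶠ s in nhdsWithin 0 (Set.Ioi 0), 0 < f s := by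
  have h := (hasDerivAt_iff_tendsto_slope.1 hf).eventually (lt_mem_nhds hf')
  have h2 : ∀ᶠ s in nhdsWithin (0 : ℝ) (Set.Ioi 0), 0 < slope f 0 s :=
    h.filter_mono (nhdsWithin_mono _ fun x hx => ne_of_gt hx)
  filter_upwards [h2, self_mem_nhdsWithin] with s hs hs0
  rw [slope_def_field, h0, sub_zero, sub_zero] at hs
  exact (div_pos_iff_of_pos_right hs0).1 hs

lemma exists_exponent {R δ : ℝ} (hR : R < 1) (hδ : 0 < δ) (α : ℝ) :
    ∃ s > 0, R * Real.exp s < 1 ∧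
      R + (1 - R) ^ 2 * Real.exp s / (1 - R * Real.exp s) ≤ Real.exp (s * (1 + δ)) ∧
      1 - α + α * Real.exp (-s) ≤ Real.exp (-(s * (α - δ))) := by
  have hexp : HasDerivAt Real.exp 1 0 := by simpa using Real.hasDerivAt_exp 0
  have hlin : ∀ a : ℝ, HasDerivAt (fun s : ℝ => Real.exp (s * a)) a 0 := by
    intro a
    simpa using ((hasDerivAt_id (0 : ℝ)).mul_const a).exp
  have h1 : HasDerivAt (fun s => Real.exp (s * (1 + δ)) * (1 - R * Real.exp s) -
      (R * (1 - R * Real.exp s) + (1 - R) ^ 2 * Real.exp s)) (δ * (1 - R)) 0 := by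
    have hq := (hexp.const_mul R).const_sub 1
    refine (((hlin (1 + δ)).mul hq).sub
      ((hq.const_mul R).add (hexp.const_mul ((1 - R) ^ 2)))).congr_deriv ?_
    simp
    ring
  have h2 : HasDerivAt (fun s => Real.exp (s * (-(α - δ))) -
      (1 - α + α * Real.exp (s * (-1)))) δ 0 := by
    exact ((hlin (-(α - δ))).sub (((hlin (-1)).const_mul α).const_add (1 - α))).congr_deriv
      (by ring)
  have hev : ∀ᶠ s in nhdsWithin (0 : ℝ) (Set.Ioi 0), R * Real.exp s < 1 := by
    have hc : Filter.Tendsto (fun s => R * Real.exp s) (nhds 0) (nhds (R * Real.exp 0)) :=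
      (Real.continuous_exp.const_mul R).tendsto 0
    rw [Real.exp_zero, mul_one] at hc
    exact (hc.eventually (gt_mem_nhds hR)).filter_mono nhdsWithin_le_nhds
  obtain ⟨s, hs1, hs2, hs3, hs0⟩ := ((eventually_pos_of_hasDerivAt h1 (by simp; ring)
    (mul_pos hδ (sub_pos.2 hR))).and ((eventually_pos_of_hasDerivAt h2 (by simp) hδ).and
    (hev.and self_mem_nhdsWithin))).exists
  refine ⟨s, hs0, hs3, ?_, ?_⟩
  · rw [← le_sub_iff_add_le', div_le_iff₀ (sub_pos.2 hs3)]
    linarith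
  · have e1 : s * (-1) = -s := by ring
    have e2 : s * (-(α - δ)) = -(s * (α - δ)) := by ring
    rw [e1, e2] at hs2
    linarith

variable {n k : ℕ}

lemma card_lowValues_add_card_highValues (n k : ℕ) :
    (lowValues n k).card + (highValues n k).card = n := by
  have := Finset.card_filter_add_card_filter_not (s := (Finset.univ : Finset (Fin n)))
    (fun a => (a : ℕ) < k)
  simpa [lowValues, highValues] using this

/-- Chernoff bound for the last departure of the stationary queues. -/
lemma stepOp_iterate_unsorted_le {b : ℝ} (hb0 : 0 < b) (hb1 : b < 1) {s : ℝ} (hs : 0 < s) (A : ℝ)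
    (t : ℕ) (σ : Equiv.Perm (Fin n)) :
    (stepOp (1 - b ^ 2) fun a b => weakLe a b)^[t] (fun σ => if Unsorted k σ then 1 else 0) σ ≤
      ENNReal.ofReal (Real.exp (s * ((lowValues n k).card + A))) *
        (ENNReal.ofReal b + ENNReal.ofReal (1 - b) * ENNReal.ofReal (Real.exp (-s))) ^ t +
      ENNReal.ofReal (Real.exp (-(s * A))) *
        (∑' g, gapWeight (ENNReal.ofReal (b / (1 + b))) (ENNReal.ofReal ((1 - b / (1 + b)) ^ 2)) g *
          ENNReal.ofReal (Real.exp s) ^ g) ^ (highValues n k).card := by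
  set N : ℝ := ((lowValues n k).card : ℝ) with hN
  set h : ℝ → ℝ≥0∞ := fun y => ENNReal.ofReal (Real.exp (s * (N - y))) with hh
  set r := b / (1 + b) with hr
  have hr0 : 0 ≤ r := by positivity
  have hr1 : 1 - r = 1 / (1 + b) := by rw [hr]; field_simp; ring
  have ha : 0 ≤ 1 - b := by linarith
  have hp : 0 ≤ 1 - b ^ 2 := by nlinarith
  have hq : 1 - (1 - b ^ 2) = b ^ 2 := by ring
  have hPQ : ENNReal.ofReal (1 - (1 - b ^ 2)) + ENNReal.ofReal (1 - b ^ 2) = 1 := by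
    rw [← ENNReal.ofReal_add (by rw [hq]; positivity) hp]
    simp
  have hαβ : ENNReal.ofReal b + ENNReal.ofReal (1 - b) = 1 := by
    rw [← ENNReal.ofReal_add hb0.le ha]
    simp
  have hw : ∑' g, gapWeight (ENNReal.ofReal r) (ENNReal.ofReal ((1 - r) ^ 2)) g = 1 := by
    have hr2 : r < 1 := by
      have : 0 < 1 - r := by rw [hr1]; positivity
      linarith
    have := tsum_gapWeight_mul_pow hr0 (sq_nonneg (1 - r)) zero_le_one (by simpa using hr2)
    simp only [ENNReal.ofReal_one, one_pow, mul_one] at this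
    rw [this, ← ENNReal.ofReal_one]
    congr 1
    have : 1 - r ≠ 0 := by linarith
    field_simp
    ring
  have hmul : ∀ y, h (y + 1) = ENNReal.ofReal (Real.exp (-s)) * h y := by
    intro y
    rw [hh, ← ENNReal.ofReal_mul (Real.exp_pos _).le, ← Real.exp_add]
    ring_nf
  have hB := listAvg_tandemVal (P := ENNReal.ofReal (1 - b ^ 2))
    (Q := ENNReal.ofReal (1 - (1 - b ^ 2))) (α := ENNReal.ofReal (1 - b)) (β := ENNReal.ofReal b)
    (r := ENNReal.ofReal r) (c := ENNReal.ofReal ((1 - r) ^ 2)) hPQ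
    (by
      rw [← ENNReal.ofReal_mul (by positivity), ← ENNReal.ofReal_mul (by positivity),
        ← ENNReal.ofReal_mul (by positivity), hr1, hr]
      congr 1
      field_simp
      ring)
    (by
      rw [hq, ← ENNReal.ofReal_mul (by positivity), ← ENNReal.ofReal_mul (by positivity),
        ← ENNReal.ofReal_mul (by positivity), ← ENNReal.ofReal_mul (by positivity),
        ← ENNReal.ofReal_add (by positivity) (by positivity), hr1, hr]
      congr 1
      field_simp
      ring)
    (by
      rw [hq, ← ENNReal.ofReal_mul (by positivity), ← ENNReal.ofReal_mul (by positivity),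
        ← ENNReal.ofReal_mul (by positivity), ← ENNReal.ofReal_mul (by positivity),
        ← ENNReal.ofReal_add (by positivity) (by positivity), hr]
      congr 1
      field_simp
      ring)
    (by
      rw [← ENNReal.ofReal_mul (by positivity), ← ENNReal.ofReal_mul (by positivity),
        ← ENNReal.ofReal_mul (by positivity),
        ← ENNReal.ofReal_add (by positivity) (by positivity), hr]
      congr 1
      field_simp
      ring) hw hmul (highValues n k).card t (-A)
  have hA : h (-A) = ENNReal.ofReal (Real.exp (s * (N + A))) := by rw [hh]; simp
  rw [← hA, ← hB, ← listAvg_pow_sum, ← listAvg_const_mul, ← listAvg_add,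
    ← listAvg_const hw (highValues n k).card ((stepOp _ _)^[t] _ σ)]
  refine listAvg_mono fun gs hgs => ?_
  by_cases hsum : (gs.sum : ℝ) ≤ A
  · refine le_add_right (stepOp_iterate_le_tandemVal hPQ hαβ (fun y hy => ?_) t hgs fun c _ => ?_)
    · rw [hh, ← ENNReal.ofReal_one]
      refine ENNReal.ofReal_le_ofReal (Real.one_le_exp (mul_nonneg hs.le ?_))
      linarith
    · refine (min_le_right _ _).trans ?_
      have h1 : ((gs.drop (highRank k σ c + 1)).sum : ℝ) ≤ gs.sum := by
        exact_mod_cast (List.drop_sublist _ _).sum_le_sum (fun _ _ => Nat.zero_le _)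
      have h2 : (0 : ℝ) ≤ (lowBefore k σ c).card := Nat.cast_nonneg _
      linarith
  · refine le_add_left ((stepOp_iterate_le_one hPQ _ t (fun τ => ?_) σ).trans ?_)
    · split_ifs <;> simp
    · rw [← ENNReal.ofReal_pow (Real.exp_pos _).le, ← ENNReal.ofReal_mul (Real.exp_pos _).le,
        ← Real.exp_nat_mul, ← Real.exp_add, ← ENNReal.ofReal_one]
      refine ENNReal.ofReal_le_ofReal (Real.one_le_exp ?_)
      push Not at hsum
      nlinarith

/-- Exponential decay of the probability not to be sorted, at times beyond the threshold. -/
lemma stepOp_iterate_unsorted_le_pow {b : ℝ} (hb0 : 0 < b) (hb1 : b < 1) {s δ : ℝ} (hs : 0 < s)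
    (hδ : 0 ≤ δ) (hM : b / (1 + b) * Real.exp s < 1)
    (hM' : b / (1 + b) + (1 - b / (1 + b)) ^ 2 * Real.exp s / (1 - b / (1 + b) * Real.exp s) ≤
      Real.exp (s * (1 + δ)))
    (hL : 1 - (1 - b) + (1 - b) * Real.exp (-s) ≤ Real.exp (-(s * (1 - b - δ)))) {t : ℕ}
    (ht : (1 + δ) * n ≤ (1 - b - 3 * δ) * t) (σ : Equiv.Perm (Fin n)) :
    (stepOp (1 - b ^ 2) fun a b => weakLe a b)^[t] (fun σ => if Unsorted k σ then 1 else 0) σ ≤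
      ENNReal.ofReal (2 * Real.exp (-(s * δ)) ^ t) := by
  have hn : ((lowValues n k).card : ℝ) + (highValues n k).card = n := by
    exact_mod_cast card_lowValues_add_card_highValues n k
  have hb : 0 ≤ 1 - b := by linarith
  refine (stepOp_iterate_unsorted_le hb0 hb1 hs
    ((1 - b - 2 * δ) * t - (lowValues n k).card) t σ).trans ?_
  rw [tsum_gapWeight_mul_pow (by positivity) (sq_nonneg _) (Real.exp_pos _).le hM,
    ← ENNReal.ofReal_mul hb, ← ENNReal.ofReal_add hb0.le (mul_nonneg hb (Real.exp_pos _).le),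
    two_mul (Real.exp (-(s * δ)) ^ t),
    ENNReal.ofReal_add (pow_nonneg (Real.exp_pos _).le t) (pow_nonneg (Real.exp_pos _).le t)]
  rw [sub_sub_cancel] at hL
  refine add_le_add ?_ ?_
  · refine (mul_le_mul_right (pow_le_pow_left' (ENNReal.ofReal_le_ofReal hL) t) _).trans ?_
    rw [← ENNReal.ofReal_pow (Real.exp_pos _).le, ← ENNReal.ofReal_mul (Real.exp_pos _).le,
      ← Real.exp_nat_mul, ← Real.exp_nat_mul, ← Real.exp_add]
    refine ENNReal.ofReal_le_ofReal (Real.exp_le_exp.2 (le_of_eq ?_))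
    ring
  · refine (mul_le_mul_right (pow_le_pow_left' (ENNReal.ofReal_le_ofReal hM') _) _).trans ?_
    rw [← ENNReal.ofReal_pow (Real.exp_pos _).le, ← ENNReal.ofReal_mul (Real.exp_pos _).le,
      ← Real.exp_nat_mul, ← Real.exp_nat_mul, ← Real.exp_add]
    refine ENNReal.ofReal_le_ofReal (Real.exp_le_exp.2 ?_)
    have h2 : 0 ≤ δ * (lowValues n k).card := by positivity
    have h1 : ((lowValues n k).card : ℝ) + (1 + δ) * (highValues n k).card + δ * t ≤
        (1 - b - 2 * δ) * t := by nlinarith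
    nlinarith [mul_le_mul_of_nonneg_left h1 hs.le]

end Bounds

section Expectation

lemma probIn_ne_one_le {n : ℕ} {p : ℝ} (hp0 : 0 ≤ p) (hp1 : p ≤ 1) (t : ℕ)
    (σ : Equiv.Perm (Fin n)) :
    Ungarian.probIn p (fun a b : Equiv.Perm (Fin n) => weakLe a b) σ t {y | y ≠ 1} ≤
      ∑ k ∈ Finset.range n, (stepOp p fun a b => weakLe a b)^[t]
        (fun σ => if Unsorted k σ then 1 else 0) σ := by
  simp only [probIn_eq hp0 hp1, ← sum_walk_mul hp0 hp1]
  rw [Finset.sum_comm]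
  refine Finset.sum_le_sum fun τ _ => ?_
  rw [← Finset.mul_sum]
  gcongr
  split_ifs with h
  · obtain ⟨k, hk, hu⟩ := exists_unsorted h
    refine le_trans ?_ (Finset.single_le_sum (fun _ _ => zero_le) (Finset.mem_range.2 hk))
    simp [hu]
  · exact zero_le

lemma exists_EpSnFrom_le {b : ℝ} (hb0 : 0 < b) (hb1 : b < 1) {δ : ℝ} (hδ : 0 < δ)
    (hδb : 3 * δ < 1 - b) :
    ∃ C, ∀ n (σ : Equiv.Perm (Fin n)),
      EpSnFrom (1 - b ^ 2) n σ ≤ (1 + δ) / (1 - b - 3 * δ) * n + C := by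
  have hp0 : 0 ≤ 1 - b ^ 2 := by nlinarith
  have hp1 : 1 - b ^ 2 ≤ 1 := by nlinarith
  have hR : b / (1 + b) < 1 := by
    rw [div_lt_one (by positivity)]
    linarith
  obtain ⟨s, hs, hM, hM', hL⟩ := exists_exponent hR hδ (1 - b)
  have hρ : Real.exp (-(s * δ)) < 1 := Real.exp_lt_one_iff.2 (by nlinarith)
  set ρ := Real.exp (-(s * δ)) with hρd
  have hρ0 : 0 < ρ := Real.exp_pos _
  have hsum : Summable fun t : ℕ => (t : ℝ) * (2 * ρ ^ t) := by
    have := (summable_pow_mul_geometric_of_norm_lt_one 1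
      (by rwa [Real.norm_of_nonneg hρ0.le] : ‖ρ‖ < 1)).mul_left 2
    refine this.congr fun t => ?_
    ring
  have hnn : ∀ t : ℕ, 0 ≤ (t : ℝ) * (2 * ρ ^ t) := fun t => by positivity
  have hd : 0 < 1 - b - 3 * δ := by linarith
  set K := (1 + δ) / (1 - b - 3 * δ) with hK
  have hK1 : 1 ≤ K := by
    rw [hK, le_div_iff₀ hd]
    linarith
  refine ⟨1 + ∑' t : ℕ, (t : ℝ) * (2 * ρ ^ t), fun n σ => ?_⟩
  have ht0 : (⌈K * n⌉₊ : ℝ) ≤ K * n + 1 := (Nat.ceil_lt_add_one (by positivity)).le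
  set t₀ := ⌈K * n⌉₊ with ht₀
  have hprob : ∀ t, Ungarian.probIn (1 - b ^ 2) (fun a b : Equiv.Perm (Fin n) => weakLe a b) σ t
      {y | y ≠ 1} ≤ (if t ∈ Finset.range t₀ then 1 else 0) +
        ENNReal.ofReal ((t : ℝ) * (2 * ρ ^ t)) := by
    intro t
    split_ifs with ht
    · refine le_add_right ?_
      rw [probIn_eq hp0 hp1]
      refine stepOp_iterate_le_one ?_ _ t (fun τ => ?_) σ
      · rw [← ENNReal.ofReal_add (by linarith) hp0]
        simp
      · split_ifs <;> simp
    · rw [Finset.mem_range, not_lt, ht₀, Nat.ceil_le] at ht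
      have hnt : (n : ℝ) ≤ t := (le_mul_of_one_le_left (Nat.cast_nonneg n) hK1).trans ht
      have ht' : (1 + δ) * n ≤ (1 - b - 3 * δ) * t := by
        rw [hK, div_mul_eq_mul_div, div_le_iff₀ hd] at ht
        linarith
      rw [zero_add]
      refine (probIn_ne_one_le hp0 hp1 t σ).trans ((Finset.sum_le_sum fun k _ =>
        stepOp_iterate_unsorted_le_pow hb0 hb1 hs hδ.le hM hM' hL ht' σ).trans ?_)
      rw [Finset.sum_const, Finset.card_range, ← ENNReal.ofReal_nsmul, nsmul_eq_mul]
      refine ENNReal.ofReal_le_ofReal ?_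
      gcongr
  have hexp : Ungarian.expAbsorb (1 - b ^ 2) (fun a b : Equiv.Perm (Fin n) => weakLe a b) σ 1 ≤
      ENNReal.ofReal (t₀ + ∑' t : ℕ, (t : ℝ) * (2 * ρ ^ t)) := by
    refine (ENNReal.tsum_le_tsum hprob).trans (le_of_eq ?_)
    rw [ENNReal.tsum_add, ← ENNReal.ofReal_tsum_of_nonneg hnn hsum,
      ENNReal.ofReal_add (Nat.cast_nonneg _) (tsum_nonneg hnn), ENNReal.ofReal_natCast]
    congr 1
    rw [tsum_eq_sum (s := Finset.range t₀) fun t ht => if_neg ht, Finset.sum_ite_mem]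
    simp
  have h1 := ENNReal.toReal_le_of_le_ofReal
    (add_nonneg (Nat.cast_nonneg _) (tsum_nonneg hnn)) hexp
  unfold EpSnFrom
  linarith

end Expectation

theorem thm1 (p : ℝ) (hp0 : 0 < p) (hp1 : p < 1) :
    Filter.limsup
      (fun n : ℕ =>
        ((((⨆ σ : Equiv.Perm (Fin n), EpSnFrom p n σ) -
            ((1 + Real.sqrt (1 - p)) / p) * n) / n : ℝ) : EReal))
      Filter.atTop ≤ (0 : EReal) := by
  set b := Real.sqrt (1 - p) with hb
  have hb2 : p = 1 - b ^ 2 := by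
    rw [hb, Real.sq_sqrt (by linarith)]
    ring
  have hb0 : 0 < b := Real.sqrt_pos.2 (by linarith)
  have hb1 : b < 1 := by nlinarith
  have hd : 0 < 1 - b := by linarith
  have hconst : (1 + b) / p = 1 / (1 - b) := by
    rw [hb2, div_eq_div_iff (by nlinarith) hd.ne']
    ring
  rw [hconst, hb2]
  refine EReal.le_of_forall_lt_iff_le.1 fun ε hε => ?_
  have hε : 0 < ε := by exact_mod_cast hε
  have hK : Filter.Tendsto (fun δ : ℝ => (1 + δ) / (1 - b - 3 * δ)) (nhds 0)
      (nhds (1 / (1 - b))) := by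
    have : ContinuousAt (fun δ : ℝ => (1 + δ) / (1 - b - 3 * δ)) 0 := by
      refine ContinuousAt.div (by fun_prop) (by fun_prop) ?_
      simpa using hd.ne'
    simpa [ContinuousAt] using this
  have hδ3 : ∀ᶠ δ in nhds (0 : ℝ), 3 * δ < 1 - b := by
    filter_upwards [gt_mem_nhds (div_pos hd three_pos)] with δ hδ
    linarith
  obtain ⟨δ, ⟨hδK, hδb⟩, hδ⟩ := ((((hK.eventually (gt_mem_nhds
    (show 1 / (1 - b) < 1 / (1 - b) + ε / 2 by linarith))).and hδ3).filter_mono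
      nhdsWithin_le_nhds).and (self_mem_nhdsWithin (s := Set.Ioi (0 : ℝ)))).exists
  obtain ⟨C, hC⟩ := exists_EpSnFrom_le hb0 hb1 hδ hδb
  refine Filter.limsup_le_of_le (by isBoundedDefault) ?_
  filter_upwards [Filter.eventually_gt_atTop 0,
    tendsto_natCast_atTop_atTop.eventually (Filter.eventually_ge_atTop (C / (ε / 2)))] with n hn hnC
  have hn' : (0 : ℝ) < n := Nat.cast_pos.2 hn
  rw [EReal.coe_le_coe_iff, div_le_iff₀ hn', sub_le_iff_le_add]
  refine ciSup_le fun σ => (hC n σ).trans ?_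
  rw [div_le_iff₀ (half_pos hε)] at hnC
  nlinarith
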